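/- Let n ≥ 2. Identify ℝ^n with ℝ^{n-2} × ℂ and let d : S^{n-1} → S^{n-1} be the degree-two map given by d(x, z) = (x, z²/‖z‖) for z ≠ 0 and d(x, 0) = (x, 0) (for n = 2 this is z ↦ z² on S¹ ⊆ ℂ). Let ι : S^{n-1} → S^{2n-1} be the standard inclusion (x ↦ (x, 0) into the first n coordinates of ℝ^{2n}). Then there exists a pseudo-isotopy of S^{2n-1} taking ι onto ι ∘ d, i.e., a continuous map H : S^{2n-1} × [0,1] → S^{2n-1} such that H(·, 0) is the identity, H(·, t) is a homeomorphism of S^{2n-1} for every t < 1, and H(·, 1) ∘ ι = ι ∘ d. -/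

import Mathlib

open Topology Metric unitInterval

/-- The unit sphere `S^{2n-1} ⊆ ℝ^{2n} = (ℝ^{n-2} × ℂ) × ℝ^n`, where `n = j + 2`. -/
def bigSphere (j : ℕ) : Type :=
  {q : (EuclideanSpace ℝ (Fin j) × ℂ) × EuclideanSpace ℝ (Fin (j + 2)) //
    ‖q.1.1‖ ^ 2 + ‖q.1.2‖ ^ 2 + ‖q.2‖ ^ 2 = 1}

noncomputable instance (j : ℕ) : TopologicalSpace (bigSphere j) :=
  inferInstanceAs (TopologicalSpace
    {q : (EuclideanSpace ℝ (Fin j) × ℂ) × EuclideanSpace ℝ (Fin (j + 2)) //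
      ‖q.1.1‖ ^ 2 + ‖q.1.2‖ ^ 2 + ‖q.2‖ ^ 2 = 1})

/-- The complex coordinate of the degree-two map `d(x, z) = (x, z²/‖z‖)`. -/
noncomputable def degTwo (z : ℂ) : ℂ :=
  if z = 0 then 0 else z ^ 2 / (‖z‖ : ℂ)

section RadialProjection

variable {E : Type*} [AddCommGroup E] [Module ℝ E]

/-- The radial projection of `F q` to the unit level set of `N`. -/
noncomputable def radialMap (N : E → ℝ) (F : E → E) (q : E) : E := (N (F q))⁻¹ • F q

variable {N : E → ℝ} {F : E → E}

lemma radialMap_mem (hN : ∀ c : ℝ, 0 < c → ∀ q, N (c • q) = c * N q) {q : E}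
    (hq : 0 < N (F q)) : N (radialMap N F q) = 1 := by
  rw [radialMap, hN _ (inv_pos.2 hq), inv_mul_cancel₀ hq.ne']

/-- A positively homogeneous bijection descends to a bijection of the unit level set of a
positively homogeneous function. -/
lemma bijective_radialMap (hN : ∀ c : ℝ, 0 < c → ∀ q, N (c • q) = c * N q)
    (hF : ∀ c : ℝ, 0 < c → ∀ q, F (c • q) = c • F q)
    (hpos : ∀ q, 0 < N (F q) ↔ 0 < N q) (hbij : Function.Bijective F) :
    Function.Bijective (fun q : {q : E // N q = 1} =>
      (⟨radialMap N F q.1, radialMap_mem hN ((hpos q.1).2 (by rw [q.2]; exact one_pos))⟩ :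
        {q : E // N q = 1})) := by
  constructor
  · rintro ⟨p, hp⟩ ⟨q, hq⟩ h
    have h1 : radialMap N F p = radialMap N F q := congrArg Subtype.val h
    have hp0 : 0 < N (F p) := (hpos p).2 (by rw [hp]; exact one_pos)
    have hq0 : 0 < N (F q) := (hpos q).2 (by rw [hq]; exact one_pos)
    have h2 : F p = F ((N (F p) * (N (F q))⁻¹) • q) := by
      rw [hF _ (by positivity), mul_smul]
      change F p = N (F p) • radialMap N F q
      rw [← h1, radialMap, smul_inv_smul₀ hp0.ne']
    have h3 := hbij.1 h2
    have h4 : N (F p) * (N (F q))⁻¹ = 1 := by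
      have := congrArg N h3
      rwa [hN _ (by positivity), hp, hq, mul_one, eq_comm] at this
    rw [h4, one_smul] at h3
    exact Subtype.ext h3
  · rintro ⟨p, hp⟩
    obtain ⟨q, rfl⟩ := hbij.2 p
    have hq : 0 < N q := (hpos q).1 (by rw [hp]; exact one_pos)
    refine ⟨⟨(N q)⁻¹ • q, by rw [hN _ (inv_pos.2 hq), inv_mul_cancel₀ hq.ne']⟩,
      Subtype.ext ?_⟩
    change radialMap N F ((N q)⁻¹ • q) = F q
    rw [radialMap, hF _ (inv_pos.2 hq), hN _ (inv_pos.2 hq), hp, mul_one, inv_inv,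
      smul_inv_smul₀ hq.ne']

end RadialProjection

lemma norm_degTwo (z : ℂ) : ‖degTwo z‖ = ‖z‖ := by
  unfold degTwo
  split_ifs with h
  · simp [h]
  · have : ‖z‖ ≠ 0 := norm_ne_zero_iff.2 h
    simp only [norm_div, norm_pow, Complex.norm_real, norm_norm]
    field_simp

lemma continuous_degTwo : Continuous degTwo := by
  rw [continuous_iff_continuousAt]
  intro z
  by_cases hz : z = 0
  · subst hz
    have h0 : degTwo 0 = 0 := by simp [degTwo]
    rw [ContinuousAt, h0, tendsto_zero_iff_norm_tendsto_zero]
    simp only [norm_degTwo]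
    simpa using (continuous_norm (E := ℂ)).tendsto 0
  · have h : ContinuousAt (fun z : ℂ => z ^ 2 / (‖z‖ : ℂ)) z :=
      ContinuousAt.div (by fun_prop) (by fun_prop) (by simpa using hz)
    refine h.congr ?_
    filter_upwards [isOpen_ne.mem_nhds hz] with w hw
    simp [degTwo, show w ≠ 0 from hw]

lemma degTwo_smul {c : ℝ} (hc : 0 < c) (z : ℂ) : degTwo (c • z) = c • degTwo z := by
  by_cases hz : z = 0
  · simp [hz, degTwo]
  · have hn : (‖z‖ : ℂ) ≠ 0 := by simpa using hz
    have hc' : (c : ℂ) ≠ 0 := by exact_mod_cast hc.ne'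
    have hcz : c • z ≠ 0 := smul_ne_zero hc.ne' hz
    rw [degTwo, if_neg hcz, degTwo, if_neg hz, norm_smul, Real.norm_of_nonneg hc.le]
    simp only [Complex.real_smul, Complex.ofReal_mul]
    field_simp

/-- The radial retraction of `ℂ` to the closed ball of radius `u`, for `0 ≤ u`. -/
noncomputable def ballRetract (u : ℝ) (v : ℂ) : ℂ := (u / max u ‖v‖) • v

lemma ballRetract_of_le {u : ℝ} {v : ℂ} (h : ‖v‖ ≤ u) : ballRetract u v = v := by
  rw [ballRetract, max_eq_left h]
  rcases eq_or_ne u 0 with rfl | hu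
  · simp [norm_le_zero_iff.1 h]
  · rw [div_self hu, one_smul]

lemma ballRetract_of_ge {u : ℝ} {v : ℂ} (h : u ≤ ‖v‖) :
    ballRetract u v = (u / ‖v‖) • v := by
  rw [ballRetract, max_eq_right h]

lemma ballRetract_smul {c : ℝ} (hc : 0 < c) (u : ℝ) (v : ℂ) :
    ballRetract (c * u) (c • v) = c • ballRetract u v := by
  rw [ballRetract, ballRetract, norm_smul, Real.norm_of_nonneg hc.le,
    ← mul_max_of_nonneg _ _ hc.le, mul_div_mul_left _ _ hc.ne', smul_comm]

lemma norm_ballRetract_le {u : ℝ} (hu : 0 ≤ u) (v : ℂ) : ‖ballRetract u v‖ ≤ ‖v‖ := by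
  rw [ballRetract, norm_smul, Real.norm_of_nonneg (by positivity)]
  exact mul_le_of_le_one_left (norm_nonneg _)
    (div_le_one_of_le₀ (le_max_left _ _) (by positivity))

lemma continuous_ballRetract : Continuous fun p : ℂ × ℂ => ballRetract ‖p.1‖ p.2 := by
  rw [continuous_iff_continuousAt]
  rintro ⟨a, b⟩
  by_cases hab : max ‖a‖ ‖b‖ = 0
  · have hb : b = 0 := norm_le_zero_iff.1 (hab ▸ le_max_right _ _)
    subst hb
    have h0 : ballRetract ‖a‖ 0 = 0 := by simp [ballRetract]
    rw [ContinuousAt, h0]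
    refine squeeze_zero_norm (a := fun p : ℂ × ℂ => ‖p.2‖)
      (fun p => norm_ballRetract_le (norm_nonneg _) _) ?_
    have h : Continuous fun p : ℂ × ℂ => ‖p.2‖ := by fun_prop
    simpa using h.tendsto (a, 0)
  · unfold ballRetract
    have h1 : ContinuousAt (fun p : ℂ × ℂ => ‖p.1‖) (a, b) := by fun_prop
    have h2 : ContinuousAt (fun p : ℂ × ℂ => max ‖p.1‖ ‖p.2‖) (a, b) := by fun_prop
    exact (h1.div h2 hab).smul continuousAt_snd

/-- For `t < 1`, subtracting `t` times the retraction to a ball is a bijection. -/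
lemma bijective_sub_smul_ballRetract {t u : ℝ} (ht0 : 0 ≤ t) (ht : t < 1) (hu : 0 ≤ u) :
    Function.Bijective fun v : ℂ => v - t • ballRetract u v := by
  have ht' : 0 < 1 - t := by linarith
  have hle : ∀ v : ℂ, ‖v‖ ≤ u → v - t • ballRetract u v = (1 - t) • v := fun v h => by
    rw [ballRetract_of_le h, sub_smul, one_smul]
  have hge : ∀ v : ℂ, u < ‖v‖ → v - t • ballRetract u v = (1 - t * u / ‖v‖) • v :=
    fun v h => by
      rw [ballRetract_of_ge h.le, sub_smul, one_smul, smul_smul, mul_div_assoc]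
  have hnle : ∀ v : ℂ, ‖v‖ ≤ u → ‖v - t • ballRetract u v‖ = (1 - t) * ‖v‖ := fun v h => by
    rw [hle v h, norm_smul, Real.norm_of_nonneg ht'.le]
  have hfac : ∀ v : ℂ, u < ‖v‖ → 0 < 1 - t * u / ‖v‖ := fun v h => by
    have hv : 0 < ‖v‖ := hu.trans_lt h
    rw [sub_pos, div_lt_one hv]
    nlinarith
  have hnge : ∀ v : ℂ, u < ‖v‖ → ‖v - t • ballRetract u v‖ = ‖v‖ - t * u := fun v h => by
    have hv : 0 < ‖v‖ := hu.trans_lt h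
    rw [hge v h, norm_smul, Real.norm_of_nonneg (hfac v h).le]
    field_simp
  constructor
  · intro v w h
    simp only at h
    have hn := congrArg norm h
    rcases le_or_gt ‖v‖ u with hv | hv <;> rcases le_or_gt ‖w‖ u with hw | hw
    · rw [hle v hv, hle w hw] at h
      exact smul_right_injective ℂ ht'.ne' h
    · rw [hnle v hv, hnge w hw] at hn
      nlinarith
    · rw [hnge v hv, hnle w hw] at hn
      nlinarith
    · rw [hnge v hv, hnge w hw] at hn
      have hvw : ‖v‖ = ‖w‖ := by linarith
      rw [hge v hv, hge w hw, hvw] at h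
      exact smul_right_injective ℂ (hfac w hw).ne' h
  · intro w
    rcases le_or_gt ‖w‖ ((1 - t) * u) with hw | hw
    · refine ⟨(1 - t)⁻¹ • w, ?_⟩
      have h : ‖(1 - t)⁻¹ • w‖ ≤ u := by
        rw [norm_smul, Real.norm_of_nonneg (inv_nonneg.2 ht'.le)]
        exact (inv_mul_le_iff₀ ht').2 hw
      simp only
      rw [hle _ h, smul_inv_smul₀ ht'.ne']
    · have hw0 : 0 < ‖w‖ := (by positivity : 0 ≤ (1 - t) * u).trans_lt hw
      have hn : ‖(1 + t * u / ‖w‖) • w‖ = ‖w‖ + t * u := by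
        rw [norm_smul, Real.norm_of_nonneg (by positivity)]
        field_simp
      have h : u < ‖(1 + t * u / ‖w‖) • w‖ := by
        rw [hn]
        linarith
      refine ⟨(1 + t * u / ‖w‖) • w, ?_⟩
      simp only
      rw [hge _ h, hn, smul_smul]
      have hs : 0 < ‖w‖ + t * u := by positivity
      have : (1 - t * u / (‖w‖ + t * u)) * (1 + t * u / ‖w‖) = 1 := by
        field_simp
        ring
      rw [this, one_smul]

/-- The linear path from the identity of `ℂ²` to `(z, w) ↦ (-w, z)`. -/
noncomputable def turn (t : ℝ) (p : ℂ × ℂ) : ℂ × ℂ :=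
  ((1 - t) • p.1 - t • p.2, t • p.1 + (1 - t) • p.2)

/-- The shear along the degree-two map. -/
noncomputable def degTwoShear (t : ℝ) (p : ℂ × ℂ) : ℂ × ℂ := (p.1 + t • degTwo p.2, p.2)

/-- The map collapsing the cone `‖v‖ ≤ ‖u‖` onto the first axis as `t` tends to `1`. -/
noncomputable def coneSqueeze (t : ℝ) (p : ℂ × ℂ) : ℂ × ℂ :=
  (p.1, p.2 - t • ballRetract ‖p.1‖ p.2)

/-- A positively homogeneous pseudo-isotopy of `ℂ²` taking `(z, 0)` to `(degTwo z, 0)`. -/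
noncomputable def doubling (t : ℝ) (p : ℂ × ℂ) : ℂ × ℂ :=
  coneSqueeze t (degTwoShear t (turn t p))

lemma bijective_turn (t : ℝ) : Function.Bijective (turn t) := by
  have hd : (1 - t) ^ 2 + t ^ 2 ≠ 0 := by nlinarith [sq_nonneg (1 - 2 * t)]
  have hd' : (1 - t : ℂ) ^ 2 + (t : ℂ) ^ 2 ≠ 0 := by exact_mod_cast hd
  refine Function.bijective_iff_has_inverse.2 ⟨fun p =>
    (((1 - t) ^ 2 + t ^ 2)⁻¹ • ((1 - t) • p.1 + t • p.2),
      ((1 - t) ^ 2 + t ^ 2)⁻¹ • ((1 - t) • p.2 - t • p.1)), fun p => ?_, fun p => ?_⟩ <;>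
  · ext1 <;> simp only [turn, Complex.real_smul] <;> push_cast <;> field_simp <;> ring

lemma bijective_degTwoShear (t : ℝ) : Function.Bijective (degTwoShear t) :=
  Function.bijective_iff_has_inverse.2
    ⟨fun p => (p.1 - t • degTwo p.2, p.2), fun p => by simp [degTwoShear],
      fun p => by simp [degTwoShear]⟩

lemma bijective_coneSqueeze {t : ℝ} (ht0 : 0 ≤ t) (ht : t < 1) :
    Function.Bijective (coneSqueeze t) := by
  have hb := fun u : ℂ => bijective_sub_smul_ballRetract ht0 ht (norm_nonneg u)
  constructor
  · rintro ⟨u, v⟩ ⟨u', v'⟩ h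
    obtain ⟨rfl, h2⟩ := Prod.ext_iff.1 h
    exact Prod.ext rfl ((hb _).1 h2)
  · rintro ⟨u, w⟩
    obtain ⟨v, hv⟩ := (hb u).2 w
    exact ⟨(u, v), Prod.ext rfl hv⟩

lemma bijective_doubling {t : ℝ} (ht0 : 0 ≤ t) (ht : t < 1) :
    Function.Bijective (doubling t) :=
  (bijective_coneSqueeze ht0 ht).comp ((bijective_degTwoShear t).comp (bijective_turn t))

lemma doubling_zero (p : ℂ × ℂ) : doubling 0 p = p := by
  simp [doubling, coneSqueeze, degTwoShear, turn]

lemma doubling_one (z : ℂ) : doubling 1 (z, 0) = (degTwo z, 0) := by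
  simp [doubling, coneSqueeze, degTwoShear, turn, norm_degTwo, ballRetract_of_le]

lemma doubling_smul (t : ℝ) {c : ℝ} (hc : 0 < c) (p : ℂ × ℂ) :
    doubling t (c • p) = c • doubling t p := by
  have h1 : turn t (c • p) = c • turn t p := by
    ext1 <;> simp only [turn, Prod.smul_fst, Prod.smul_snd, Complex.real_smul] <;> ring
  have h2 : ∀ p, degTwoShear t (c • p) = c • degTwoShear t p := fun p => by
    ext1
    · simp only [degTwoShear, Prod.smul_fst, Prod.smul_snd, degTwo_smul hc, smul_add]
      rw [smul_comm]
    · rfl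
  have h3 : ∀ p, coneSqueeze t (c • p) = c • coneSqueeze t p := fun p => by
    ext1
    · rfl
    · simp only [coneSqueeze, Prod.smul_fst, Prod.smul_snd, norm_smul,
        Real.norm_of_nonneg hc.le, ballRetract_smul hc, smul_sub]
      rw [smul_comm]
  rw [doubling, h1, h2, h3, doubling]

lemma doubling_eq_zero_iff {t : ℝ} {p : ℂ × ℂ} : doubling t p = 0 ↔ p = 0 := by
  have h0 : degTwo 0 = 0 := by simp [degTwo]
  have hz : turn t 0 = 0 := by simp [turn]
  constructor
  · intro h
    rw [← (bijective_turn t).1.eq_iff, hz]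
    have h1 : (turn t p).1 + t • degTwo (turn t p).2 = 0 := congrArg Prod.fst h
    have h2 : (turn t p).2 -
        t • ballRetract ‖(turn t p).1 + t • degTwo (turn t p).2‖ (turn t p).2 = 0 :=
      congrArg Prod.snd h
    have h3 : (turn t p).2 = 0 := by
      rw [h1] at h2
      simpa [ballRetract] using h2
    rw [h3, h0, smul_zero, add_zero] at h1
    exact Prod.ext h1 h3
  · rintro rfl
    rw [doubling, hz]
    simp [degTwoShear, coneSqueeze, h0, ballRetract]

lemma continuous_doubling : Continuous fun p : ℝ × ℂ × ℂ => doubling p.1 p.2 := by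
  have h1 : Continuous fun p : ℝ × ℂ × ℂ => turn p.1 p.2 := by
    unfold turn
    fun_prop
  have h2 : Continuous fun p : ℝ × ℂ × ℂ => degTwoShear p.1 p.2 := by
    have := continuous_degTwo
    unfold degTwoShear
    fun_prop
  have h3 : Continuous fun p : ℝ × ℂ × ℂ => coneSqueeze p.1 p.2 := by
    have := continuous_ballRetract.comp (continuous_snd (X := ℝ) (Y := ℂ × ℂ))
    exact (continuous_fst.comp continuous_snd).prodMk
      ((continuous_snd.comp continuous_snd).sub (continuous_fst.smul this))
  exact h3.comp (continuous_fst.prodMk (h2.comp (continuous_fst.prodMk h1)))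

section Ambient

set_option linter.unusedSectionVars false

variable {X Y W : Type*} [NormedAddCommGroup X] [NormedSpace ℝ X]
  [NormedAddCommGroup Y] [NormedSpace ℝ Y] [NormedAddCommGroup W] [NormedSpace ℝ W]

/-- The map `doubling t` on a complex plane inside `(X × ℂ) × W`, where `e` splits off the second
complex coordinate from `W`, and the identity on the remaining coordinates. -/
noncomputable def ambientDoubling (e : W ≃L[ℝ] ℂ × Y) (t : ℝ) (q : (X × ℂ) × W) :
    (X × ℂ) × W :=
  ((q.1.1, (doubling t (q.1.2, (e q.2).1)).1),
    e.symm ((doubling t (q.1.2, (e q.2).1)).2, (e q.2).2))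

variable (e : W ≃L[ℝ] ℂ × Y)

lemma bijective_ambientDoubling {t : ℝ} (ht0 : 0 ≤ t) (ht : t < 1) :
    Function.Bijective (ambientDoubling (X := X) e t) := by
  have hb := bijective_doubling ht0 ht
  constructor
  · rintro ⟨⟨x, z⟩, w⟩ ⟨⟨x', z'⟩, w'⟩ h
    simp only [ambientDoubling, Prod.mk.injEq, EmbeddingLike.apply_eq_iff_eq] at h
    obtain ⟨⟨rfl, h1⟩, h2, h3⟩ := h
    have h4 := Prod.ext_iff.1 (hb.1 (Prod.ext h1 h2))
    have h5 : w = w' := e.injective (Prod.ext h4.2 h3)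
    exact Prod.ext (Prod.ext rfl h4.1) h5
  · rintro ⟨⟨x, z⟩, w⟩
    obtain ⟨⟨a, b⟩, hab⟩ := hb.2 (z, (e w).1)
    exact ⟨((x, a), e.symm (b, (e w).2)), by simp [ambientDoubling, hab]⟩

lemma ambientDoubling_zero (q : (X × ℂ) × W) : ambientDoubling e 0 q = q := by
  simp [ambientDoubling, doubling_zero]

lemma ambientDoubling_one (x : X) (z : ℂ) :
    ambientDoubling e 1 ((x, z), 0) = ((x, degTwo z), 0) := by
  simp [ambientDoubling, doubling_one, ← Prod.zero_eq_mk]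

lemma ambientDoubling_smul (t : ℝ) {c : ℝ} (hc : 0 < c) (q : (X × ℂ) × W) :
    ambientDoubling e t (c • q) = c • ambientDoubling e t q := by
  have h := doubling_smul t hc (q.1.2, (e q.2).1)
  simp only [Prod.smul_mk] at h
  simp only [ambientDoubling, Prod.smul_fst, Prod.smul_snd, map_smul, h, Prod.smul_mk,
    ← map_smul e.symm]

lemma ambientDoubling_eq_zero_iff {t : ℝ} {q : (X × ℂ) × W} :
    ambientDoubling e t q = 0 ↔ q = 0 := by
  obtain ⟨⟨x, z⟩, w⟩ := q
  constructor
  · intro h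
    simp only [ambientDoubling, Prod.mk_eq_zero, EmbeddingLike.map_eq_zero_iff] at h
    obtain ⟨⟨rfl, h1⟩, h2, h3⟩ := h
    obtain ⟨rfl, h4⟩ := Prod.ext_iff.1 (doubling_eq_zero_iff.1 (Prod.ext h1 h2))
    have h5 : w = 0 := e.map_eq_zero_iff.1 (Prod.ext h4 h3)
    rw [h5]
    rfl
  · intro h
    simp only [Prod.mk_eq_zero] at h
    obtain ⟨⟨rfl, rfl⟩, rfl⟩ := h
    have h0 : doubling t (0 : ℂ × ℂ) = 0 := doubling_eq_zero_iff.2 rfl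
    simp [ambientDoubling, h0, ← Prod.zero_eq_mk]

lemma continuous_ambientDoubling :
    Continuous fun p : ((X × ℂ) × W) × ℝ => ambientDoubling e p.2 p.1 := by
  have h : Continuous fun p : ((X × ℂ) × W) × ℝ =>
      doubling p.2 (p.1.1.2, (e p.1.2).1) :=
    continuous_doubling.comp (f := fun p : ((X × ℂ) × W) × ℝ => (p.2, p.1.1.2, (e p.1.2).1))
      (by fun_prop)
  have h2 : Continuous fun p : ((X × ℂ) × W) × ℝ => (e p.1.2).2 := by fun_prop
  exact (continuous_fst.fst.fst.prodMk h.fst).prodMk (e.symm.continuous.comp (h.snd.prodMk h2))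

/-- The Euclidean norm on `(X × ℂ) × W`. -/
noncomputable def euclNorm (q : (X × ℂ) × W) : ℝ :=
  √(‖q.1.1‖ ^ 2 + ‖q.1.2‖ ^ 2 + ‖q.2‖ ^ 2)

lemma euclNorm_smul (c : ℝ) (hc : 0 < c) (q : (X × ℂ) × W) :
    euclNorm (c • q) = c * euclNorm q := by
  simp only [euclNorm, Prod.smul_fst, Prod.smul_snd, norm_smul, Real.norm_of_nonneg hc.le]
  rw [← Real.sqrt_sq hc.le, ← Real.sqrt_mul (sq_nonneg c), Real.sqrt_sq hc.le]
  ring_nf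

lemma euclNorm_pos {q : (X × ℂ) × W} : 0 < euclNorm q ↔ q ≠ 0 := by
  rw [euclNorm, Real.sqrt_pos]
  constructor
  · rintro h rfl
    simp at h
  · contrapose!
    intro h
    have h1 := sq_nonneg ‖q.1.1‖
    have h2 := sq_nonneg ‖q.1.2‖
    have h3 := sq_nonneg ‖q.2‖
    refine Prod.ext (Prod.ext ?_ ?_) ?_ <;>
    · refine norm_eq_zero.1 (pow_eq_zero_iff two_ne_zero |>.1 ?_)
      linarith

lemma euclNorm_eq_one {q : (X × ℂ) × W} :
    euclNorm q = 1 ↔ ‖q.1.1‖ ^ 2 + ‖q.1.2‖ ^ 2 + ‖q.2‖ ^ 2 = 1 := Real.sqrt_eq_one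

lemma continuous_euclNorm : Continuous (euclNorm : (X × ℂ) × W → ℝ) := by
  unfold euclNorm
  fun_prop

lemma isCompact_euclNorm_eq_one [ProperSpace X] [ProperSpace W] :
    IsCompact {q : (X × ℂ) × W | euclNorm q = 1} := by
  refine (isCompact_closedBall (0 : (X × ℂ) × W) 1).of_isClosed_subset
    (isClosed_singleton.preimage continuous_euclNorm) fun q hq => ?_
  have h := euclNorm_eq_one.1 hq
  rw [mem_closedBall_zero_iff]
  have h1 := sq_nonneg ‖q.1.1‖
  have h2 := sq_nonneg ‖q.1.2‖
  have h3 := sq_nonneg ‖q.2‖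
  refine max_le (max_le ?_ ?_) ?_ <;>
    exact (sq_le_one_iff₀ (norm_nonneg _)).1 (by linarith)

lemma euclNorm_ambientDoubling_pos (t : ℝ) (q : (X × ℂ) × W) :
    0 < euclNorm (ambientDoubling e t q) ↔ 0 < euclNorm q := by
  rw [euclNorm_pos, euclNorm_pos, Ne, ambientDoubling_eq_zero_iff]

/-- The Euclidean unit sphere of `(X × ℂ) × W` admits a pseudo-isotopy realising `degTwo`. -/
theorem exists_pseudoIsotopy_degTwo [ProperSpace X] [ProperSpace W] (e : W ≃L[ℝ] ℂ × Y) :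
    ∃ H : {q : (X × ℂ) × W // euclNorm q = 1} × unitInterval →
        {q : (X × ℂ) × W // euclNorm q = 1},
      Continuous H ∧ (∀ q, H (q, 0) = q) ∧
      (∀ t : unitInterval, (t : ℝ) < 1 → IsHomeomorph fun q => H (q, t)) ∧
      ∀ q x z, q.1 = ((x, z), 0) → (H (q, 1)).1 = ((x, degTwo z), 0) := by
  have hpos : ∀ (q : {q : (X × ℂ) × W // euclNorm q = 1}) (t : ℝ),
      0 < euclNorm (ambientDoubling e t q.1) := fun q t =>
    (euclNorm_ambientDoubling_pos e t q.1).2 (by rw [q.2]; exact one_pos)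
  let H : {q : (X × ℂ) × W // euclNorm q = 1} × unitInterval →
      {q : (X × ℂ) × W // euclNorm q = 1} := fun p =>
    ⟨radialMap euclNorm (ambientDoubling e p.2) p.1.1,
      radialMap_mem euclNorm_smul (hpos p.1 p.2)⟩
  have hH : Continuous H := by
    have h : Continuous fun p : {q : (X × ℂ) × W // euclNorm q = 1} × unitInterval =>
        ambientDoubling e p.2 p.1.1 :=
      (continuous_ambientDoubling e).comp
        (f := fun p : {q : (X × ℂ) × W // euclNorm q = 1} × unitInterval =>
          (p.1.1, (p.2 : ℝ))) (by fun_prop)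
    exact (((continuous_euclNorm.comp h).inv₀ fun p => (hpos p.1 p.2).ne').smul
      h).subtype_mk _
  have : CompactSpace {q : (X × ℂ) × W // euclNorm q = 1} :=
    isCompact_iff_compactSpace.1 isCompact_euclNorm_eq_one
  refine ⟨H, hH, fun q => Subtype.ext ?_, fun t ht => ?_, fun q x z hq => ?_⟩
  · simp [H, radialMap, ambientDoubling_zero, q.2]
  · exact isHomeomorph_iff_continuous_bijective.2 ⟨by fun_prop,
      bijective_radialMap euclNorm_smul (fun c hc q => ambientDoubling_smul e t hc q)
        (euclNorm_ambientDoubling_pos e t) (bijective_ambientDoubling e t.2.1 ht)⟩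
  · have h1 : euclNorm (((x, degTwo z), 0) : (X × ℂ) × W) = 1 := by
      rw [← q.2, hq]
      simp [euclNorm, norm_degTwo]
    simp [H, radialMap, hq, ambientDoubling_one, h1]

end Ambient

/-- Remark after Example 2.7: there is a pseudo-isotopy of `S^{2n-1}` (for `n = j+2 ≥ 2`)
taking the standard inclusion `ι : S^{n-1} → S^{2n-1}` onto `ι ∘ d`, where `d` is the
degree-two self-map `(x, z) ↦ (x, z²/‖z‖)` of `S^{n-1} ⊆ ℝ^{n-2} × ℂ`. -/
theorem stmt18 (j : ℕ) :
    ∃ H : bigSphere j × unitInterval → bigSphere j,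
      Continuous H ∧
      (∀ q, H (q, 0) = q) ∧
      (∀ t : unitInterval, (t : ℝ) < 1 → IsHomeomorph (fun q => H (q, t))) ∧
      (∀ (x : EuclideanSpace ℝ (Fin j)) (z : ℂ) (h : ‖x‖ ^ 2 + ‖z‖ ^ 2 = 1),
        (H (⟨((x, z), 0), by simpa using h⟩, 1)).val = ((x, degTwo z), 0)) := by
  have hfr : Module.finrank ℝ (EuclideanSpace ℝ (Fin (j + 2))) =
      Module.finrank ℝ (ℂ × EuclideanSpace ℝ (Fin j)) := by
    simp [add_comm]
  obtain ⟨H, hc, h0, ht, h1⟩ := exists_pseudoIsotopy_degTwo (X := EuclideanSpace ℝ (Fin j))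
    (ContinuousLinearEquiv.ofFinrankEq hfr)
  let φ : bigSphere j ≃ₜ {q : (EuclideanSpace ℝ (Fin j) × ℂ) × EuclideanSpace ℝ (Fin (j + 2)) //
      euclNorm q = 1} :=
    (Homeomorph.refl _).subtype fun q => euclNorm_eq_one.symm
  refine ⟨fun p => φ.symm (H (φ p.1, p.2)), by fun_prop, fun q => by simp [h0],
    fun t h => φ.symm.isHomeomorph.comp ((ht t h).comp φ.isHomeomorph), fun x z h => ?_⟩
  exact h1 _ x z rfl
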